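/- Let λ>0, 0<q<1, p=1, and let v be a non-negative measurable weight on (0,∞). Denote v̄₀(t)=ess sup_{0<x<t} v(x). If B=(∫_0^∞ t^{−λ/(1−q)−1} v̄₀(t)^{q/(1−q)} dt)^{(1−q)/q} < ∞, then the Laplace-type operator 𝓛 is compact from L^1 to L^q. Conversely, if 𝓛 is compact from L^1 to L^q, then ess sup_{t>0} t^{−λ/q} v(t) < ∞. -/

import Mathlib

open MeasureTheory Set Filter Topology
open scoped ENNReal NNReal

noncomputable section

/-- The Laplace-type operator `𝓛f(x) = ∫_0^∞ e^{-x y^λ} f(y) v(y) dy`. -/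
def Lap (lam : ℝ) (v f : ℝ → ℝ) : ℝ → ℝ :=
  fun x => ∫ y in Ioi (0:ℝ), Real.exp (-(x * y ^ lam)) * f y * v y

/-- `(∫_0^∞ |g|^r)^{1/r}`, the `L^r(0,∞)` (quasi-)norm. -/
def eN (r : ℝ) (g : ℝ → ℝ) : ℝ≥0∞ :=
  (∫⁻ x in Ioi (0:ℝ), ENNReal.ofReal |g x| ^ r) ^ (1/r)

/-- The metric functional `d(g,0) = ∫_0^∞ |g|^q` of the complete metric space `L^q`, `0<q<1`. -/
def dM (q : ℝ) (g : ℝ → ℝ) : ℝ≥0∞ :=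
  ∫⁻ x in Ioi (0:ℝ), ENNReal.ofReal |g x| ^ q

/-- Compactness of the Laplace-type operator from `L^p` to `L^q`, `0<q<1`: every sequence
of the closed unit ball of `L^p` admits a subsequence whose image is Cauchy (equivalently,
convergent) for the metric `d(f,g)=∫_0^∞|f-g|^q` of the complete metric space `L^q`. -/
def LapCompactM (lam p q : ℝ) (v : ℝ → ℝ) : Prop :=
  ∀ f : ℕ → ℝ → ℝ, (∀ n, Measurable (f n)) → (∀ n, eN p (f n) ≤ 1) →
    ∃ φ : ℕ → ℕ, StrictMono φ ∧
      ∀ ε : ℝ, 0 < ε → ∃ N : ℕ, ∀ m, N ≤ m → ∀ n, N ≤ n →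
        dM q (fun x => Lap lam v (f (φ m)) x - Lap lam v (f (φ n)) x) < ENNReal.ofReal ε

theorem ENNReal.rpow_tsum_le_tsum_rpow {ι : Type*} (a : ι → ℝ≥0∞) {q : ℝ} (hq0 : 0 < q)
    (hq1 : q ≤ 1) : (∑' i, a i) ^ q ≤ ∑' i, a i ^ q := by
  have hfin : ∀ s : Finset ι, (∑ i ∈ s, a i) ^ q ≤ ∑ i ∈ s, a i ^ q := by
    intro s
    classical
    induction s using Finset.induction_on with
    | empty => simp [ENNReal.zero_rpow_of_pos hq0]
    | insert i s hi ih =>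
      rw [Finset.sum_insert hi, Finset.sum_insert hi]
      exact (ENNReal.rpow_add_le_add_rpow _ _ hq0.le hq1).trans (by gcongr)
  have hlim : Tendsto (fun s : Finset ι => (∑ i ∈ s, a i) ^ q) atTop (𝓝 ((∑' i, a i) ^ q)) :=
    ((ENNReal.continuous_rpow_const (y := q)).tendsto _).comp ENNReal.summable.hasSum
  exact le_of_tendsto' hlim fun s => (hfin s).trans (ENNReal.sum_le_tsum s)

theorem ENNReal.tsum_mul_rpow_le {ι : Type*} (a P : ι → ℝ≥0∞) {q : ℝ}
    (hq0 : 0 < q) (hq1 : q < 1) :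
    ∑' i, a i * P i ^ q ≤ (∑' i, a i ^ (1 / (1 - q))) ^ (1 - q) * (∑' i, P i) ^ q := by
  let _ : MeasurableSpace ι := ⊤
  have hpq : (1 / (1 - q)).HolderConjugate (1 / q) := by
    rw [Real.holderConjugate_iff]
    constructor
    · rw [lt_div_iff₀ (by linarith)]; linarith
    · simp
  have key := ENNReal.lintegral_mul_le_Lp_mul_Lq (Measure.count : Measure ι) hpq
    (f := a) (g := fun i => P i ^ q) (by fun_prop) (by fun_prop)
  simp only [Pi.mul_apply, lintegral_count, one_div_one_div, ← ENNReal.rpow_mul,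
    mul_one_div_cancel hq0.ne', ENNReal.rpow_one] at key
  exact key

theorem lintegral_exp_neg_mul_Ioi {c : ℝ} (hc : 0 < c) :
    ∫⁻ x in Ioi (0 : ℝ), ENNReal.ofReal (Real.exp (-(x * c))) = ENNReal.ofReal (1 / c) := by
  have hfun : (fun x : ℝ => Real.exp (-(x * c))) = fun x => Real.exp (-c * x) := by
    funext x; congr 1; ring
  rw [← ofReal_integral_eq_lintegral_ofReal]
  · rw [hfun, integral_exp_mul_Ioi (by linarith)]
    congr 1
    simp
  · rw [hfun]
    exact integrableOn_exp_mul_Ioi (by linarith) 0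
  · exact Eventually.of_forall fun x => (Real.exp_pos _).le

/-- `∫_0^∞ (e^{-xc} A)^q dx = A^q / (qc)`. -/
theorem lintegral_exp_mul_rpow {c q : ℝ} (hc : 0 < c) (hq : 0 < q) (A : ℝ≥0∞) :
    ∫⁻ x in Ioi (0 : ℝ), (ENNReal.ofReal (Real.exp (-(x * c))) * A) ^ q
      = ENNReal.ofReal (1 / (c * q)) * A ^ q := by
  rw [← lintegral_exp_neg_mul_Ioi (mul_pos hc hq), ← lintegral_mul_const _ (by fun_prop)]
  congr 1
  funext x
  rw [ENNReal.mul_rpow_of_nonneg _ _ hq.le, ENNReal.ofReal_rpow_of_pos (Real.exp_pos _),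
    ← Real.exp_mul]
  congr 3
  ring

/-- The dyadic interval `[2^k, 2^{k+1})`. -/
def dyadic (k : ℤ) : Set ℝ := Ico ((2 : ℝ) ^ k) ((2 : ℝ) ^ (k + 1))

theorem measurableSet_dyadic (k : ℤ) : MeasurableSet (dyadic k) := measurableSet_Ico

theorem dyadic_subset_Ioi (k : ℤ) : dyadic k ⊆ Ioi 0 :=
  fun _ hy => lt_of_lt_of_le (by positivity) hy.1

theorem dyadic_subset_Ici (k : ℤ) : dyadic k ⊆ Ici ((2 : ℝ) ^ k) := Ico_subset_Ici_self

theorem pairwise_disjoint_dyadic : Pairwise (Function.onFun Disjoint dyadic) :=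
  (zpow_right_mono₀ (one_le_two (α := ℝ))).pairwise_disjoint_on_Ico_succ

theorem iUnion_dyadic : ⋃ k, dyadic k = Ioi (0 : ℝ) := by
  ext y
  simp only [mem_iUnion]
  exact ⟨fun ⟨k, hk⟩ => dyadic_subset_Ioi k hk, fun hy => exists_mem_Ico_zpow hy one_lt_two⟩

theorem lintegral_Ioi_eq_tsum_dyadic (g : ℝ → ℝ≥0∞) :
    ∫⁻ y in Ioi (0 : ℝ), g y = ∑' k, ∫⁻ y in dyadic k, g y := by
  rw [← iUnion_dyadic, lintegral_iUnion measurableSet_dyadic pairwise_disjoint_dyadic]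

/-- The integrand of the Laplace-type operator. -/
def lapKernel (lam : ℝ) (v f : ℝ → ℝ) (x y : ℝ) : ℝ := Real.exp (-(x * y ^ lam)) * f y * v y

section

variable {lam q : ℝ} {v f : ℝ → ℝ}

theorem measurable_lapKernel_uncurry (hv : Measurable v) (hf : Measurable f) :
    Measurable (Function.uncurry (lapKernel lam v f)) := by
  unfold lapKernel Function.uncurry
  fun_prop

theorem measurable_lapKernel (hv : Measurable v) (hf : Measurable f) (x : ℝ) :
    Measurable (lapKernel lam v f x) := by
  unfold lapKernel
  fun_prop

theorem measurable_Lap (hv : Measurable v) (hf : Measurable f) : Measurable (Lap lam v f) :=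
  ((measurable_lapKernel_uncurry hv hf).stronglyMeasurable.integral_prod_right
    (ν := volume.restrict (Ioi (0 : ℝ)))).measurable

theorem Lap_indicator {E : Set ℝ} (hE : MeasurableSet E) (hE0 : E ⊆ Ioi 0) (x : ℝ) :
    Lap lam v (E.indicator f) x = ∫ y in E, lapKernel lam v f x y := by
  have : (fun y => Real.exp (-(x * y ^ lam)) * E.indicator f y * v y)
      = E.indicator (lapKernel lam v f x) := by
    funext y
    by_cases hy : y ∈ E <;> simp [hy, lapKernel]
  rw [Lap, this, setIntegral_indicator hE, inter_eq_self_of_subset_right hE0]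

theorem lintegral_lapKernel_le {E : Set ℝ} (hE : MeasurableSet E) {b : ℝ} (hb : 0 < b)
    (hEb : E ⊆ Ici b) (hlam : 0 < lam) (hf : Measurable f) {V : ℝ≥0∞}
    (hV : ∀ᵐ y ∂volume.restrict E, ‖v y‖ₑ ≤ V) {x : ℝ} (hx : 0 ≤ x) :
    ∫⁻ y in E, ‖lapKernel lam v f x y‖ₑ
      ≤ ENNReal.ofReal (Real.exp (-(x * b ^ lam))) * (V * ∫⁻ y in E, ‖f y‖ₑ) := by
  rw [← lintegral_const_mul _ (by fun_prop), ← lintegral_const_mul _ (by fun_prop)]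
  refine lintegral_mono_ae ?_
  filter_upwards [hV, ae_restrict_mem hE] with y hy hyE
  have hexp : ‖Real.exp (-(x * y ^ lam))‖ₑ ≤ ENNReal.ofReal (Real.exp (-(x * b ^ lam))) := by
    rw [Real.enorm_eq_ofReal (Real.exp_pos _).le]
    have := Real.rpow_le_rpow hb.le (hEb hyE) hlam.le
    gcongr
  rw [lapKernel, enorm_mul, enorm_mul, mul_assoc, mul_comm ‖f y‖ₑ]
  gcongr

/-- Pointwise bound for the contribution of a set bounded away from `0`. -/
theorem enorm_Lap_indicator_le {E : Set ℝ} (hE : MeasurableSet E) {b : ℝ} (hb : 0 < b)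
    (hEb : E ⊆ Ici b) (hlam : 0 < lam) (hf : Measurable f) {V : ℝ≥0∞}
    (hV : ∀ᵐ y ∂volume.restrict E, ‖v y‖ₑ ≤ V) {x : ℝ} (hx : 0 ≤ x) :
    ‖Lap lam v (E.indicator f) x‖ₑ
      ≤ ENNReal.ofReal (Real.exp (-(x * b ^ lam))) * (V * ∫⁻ y in E, ‖f y‖ₑ) := by
  rw [Lap_indicator hE fun y hy => hb.trans_le (hEb hy)]
  exact (enorm_integral_le_lintegral_enorm _).trans
    (lintegral_lapKernel_le hE hb hEb hlam hf hV hx)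

theorem dM_eq (g : ℝ → ℝ) : dM q g = ∫⁻ x in Ioi (0 : ℝ), ‖g x‖ₑ ^ q := by
  simp only [dM, Real.enorm_eq_ofReal_abs]

theorem dM_Lap_indicator_le {E : Set ℝ} (hE : MeasurableSet E) {b : ℝ} (hb : 0 < b)
    (hEb : E ⊆ Ici b) (hlam : 0 < lam) (hq0 : 0 < q) (hf : Measurable f) {V : ℝ≥0∞}
    (hV : ∀ᵐ y ∂volume.restrict E, ‖v y‖ₑ ≤ V) :
    dM q (Lap lam v (E.indicator f))
      ≤ ENNReal.ofReal (1 / (b ^ lam * q)) * V ^ q * (∫⁻ y in E, ‖f y‖ₑ) ^ q := by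
  rw [dM_eq, mul_assoc, ← ENNReal.mul_rpow_of_nonneg _ _ hq0.le,
    ← lintegral_exp_mul_rpow (by positivity) hq0]
  refine setLIntegral_mono' measurableSet_Ioi fun x hx => ?_
  gcongr
  exact enorm_Lap_indicator_le hE hb hEb hlam hf hV (le_of_lt hx)

theorem enorm_Lap_le_tsum {x : ℝ} (hint : IntegrableOn (lapKernel lam v f x) (Ioi 0)) :
    ‖Lap lam v f x‖ₑ ≤ ∑' k, ‖Lap lam v ((dyadic k).indicator f) x‖ₑ := by
  have hsum := hasSum_integral_iUnion measurableSet_dyadic pairwise_disjoint_dyadic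
    (by rw [iUnion_dyadic]; exact hint)
  rw [iUnion_dyadic] at hsum
  simp only [Lap_indicator (measurableSet_dyadic _) (dyadic_subset_Ioi _)]
  change ‖∫ y in Ioi 0, lapKernel lam v f x y‖ₑ ≤ _
  rw [← hsum.tsum_eq]
  exact enorm_tsum_le_tsum_enorm

/-- The constants governing the norm of the dyadic pieces. -/
def dyadicConst (lam q : ℝ) (V : ℤ → ℝ≥0∞) (k : ℤ) : ℝ≥0∞ :=
  ENNReal.ofReal (1 / (((2 : ℝ) ^ k) ^ lam * q)) * V k ^ q

theorem ae_integrableOn_lapKernel (hlam : 0 < lam) (hq0 : 0 < q) (hq1 : q < 1) (hv : Measurable v)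
    (hf : Measurable f) (hf1 : ∫⁻ y in Ioi (0 : ℝ), ‖f y‖ₑ ≠ ⊤) {V : ℤ → ℝ≥0∞}
    (hV : ∀ k, ∀ᵐ y ∂volume.restrict (dyadic k), ‖v y‖ₑ ≤ V k)
    (hC : ∑' k, dyadicConst lam q V k ^ (1 / (1 - q)) ≠ ⊤) :
    ∀ᵐ x ∂volume.restrict (Ioi (0 : ℝ)), IntegrableOn (lapKernel lam v f x) (Ioi 0) := by
  have hmeas : Measurable fun x => (∫⁻ y in Ioi (0 : ℝ), ‖lapKernel lam v f x y‖ₑ) ^ q :=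
    ((measurable_lapKernel_uncurry hv hf).enorm.lintegral_prod_right').pow_const q
  have hfin : ∫⁻ x in Ioi (0 : ℝ), (∫⁻ y in Ioi (0 : ℝ), ‖lapKernel lam v f x y‖ₑ) ^ q ≠ ⊤ := by
    refine ne_top_of_le_ne_top (b := (∑' k, dyadicConst lam q V k ^ (1 / (1 - q))) ^ (1 - q) *
      (∑' k, ∫⁻ y in dyadic k, ‖f y‖ₑ) ^ q) ?_ ?_
    · rw [← lintegral_Ioi_eq_tsum_dyadic]
      exact ENNReal.mul_ne_top (ENNReal.rpow_ne_top_of_nonneg (by linarith) hC)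
        (ENNReal.rpow_ne_top_of_nonneg hq0.le hf1)
    · refine le_trans ?_ (ENNReal.tsum_mul_rpow_le _ _ hq0 hq1)
      calc _ ≤ ∫⁻ x in Ioi (0 : ℝ), ∑' k, (ENNReal.ofReal (Real.exp (-(x * ((2 : ℝ) ^ k) ^ lam)))
              * (V k * ∫⁻ y in dyadic k, ‖f y‖ₑ)) ^ q := by
            refine setLIntegral_mono' measurableSet_Ioi fun x hx => ?_
            rw [lintegral_Ioi_eq_tsum_dyadic]
            refine (ENNReal.rpow_tsum_le_tsum_rpow _ hq0 hq1.le).trans ?_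
            refine ENNReal.tsum_le_tsum fun k => ?_
            gcongr
            exact lintegral_lapKernel_le (measurableSet_dyadic k) (by positivity)
              (dyadic_subset_Ici k) hlam hf (hV k) (le_of_lt hx)
        _ = ∑' k, dyadicConst lam q V k * (∫⁻ y in dyadic k, ‖f y‖ₑ) ^ q := by
            rw [lintegral_tsum fun k => by fun_prop]
            refine tsum_congr fun k => ?_
            rw [lintegral_exp_mul_rpow (by positivity) hq0, dyadicConst, mul_assoc,
              ENNReal.mul_rpow_of_nonneg _ _ hq0.le]
  filter_upwards [ae_lt_top hmeas hfin] with x hx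
  refine ⟨(measurable_lapKernel hv hf x).aestronglyMeasurable, ?_⟩
  exact (ENNReal.rpow_lt_top_iff_of_pos hq0).1 hx

theorem lintegral_enorm_sub_le_two {g : ℝ → ℝ} (hf : Measurable f)
    (hf1 : ∫⁻ y in Ioi (0 : ℝ), ‖f y‖ₑ ≤ 1) (hg1 : ∫⁻ y in Ioi (0 : ℝ), ‖g y‖ₑ ≤ 1) :
    ∫⁻ y in Ioi (0 : ℝ), ‖(f - g) y‖ₑ ≤ 2 := by
  calc _ ≤ ∫⁻ y in Ioi (0 : ℝ), (‖f y‖ₑ + ‖g y‖ₑ) := lintegral_mono fun y => enorm_sub_le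
    _ = (∫⁻ y in Ioi (0 : ℝ), ‖f y‖ₑ) + ∫⁻ y in Ioi (0 : ℝ), ‖g y‖ₑ :=
        lintegral_add_left (by fun_prop) _
    _ ≤ 1 + 1 := by gcongr
    _ = 2 := one_add_one_eq_two

theorem integrableOn_lapKernel_dyadic (hlam : 0 < lam) (hv : Measurable v)
    (hf : Measurable f) (hf1 : ∫⁻ y in Ioi (0 : ℝ), ‖f y‖ₑ ≠ ⊤) {V : ℝ≥0∞} (hVtop : V ≠ ⊤) {k : ℤ}
    (hV : ∀ᵐ y ∂volume.restrict (dyadic k), ‖v y‖ₑ ≤ V) {x : ℝ} (hx : 0 ≤ x) :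
    IntegrableOn (lapKernel lam v f x) (dyadic k) := by
  refine ⟨(measurable_lapKernel hv hf x).aestronglyMeasurable, ?_⟩
  refine (lintegral_lapKernel_le (measurableSet_dyadic k) (by positivity : (0 : ℝ) < 2 ^ k)
    (dyadic_subset_Ici k) hlam hf hV hx).trans_lt ?_
  have hdy : ∫⁻ y in dyadic k, ‖f y‖ₑ ≠ ⊤ :=
    ne_top_of_le_ne_top hf1 (lintegral_mono_set (dyadic_subset_Ioi k))
  exact ENNReal.mul_lt_top ENNReal.ofReal_lt_top (ENNReal.mul_lt_top hVtop.lt_top hdy.lt_top)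

theorem lapKernel_sub (f g : ℝ → ℝ) (x : ℝ) :
    lapKernel lam v (f - g) x = lapKernel lam v f x - lapKernel lam v g x := by
  funext y
  simp only [lapKernel, Pi.sub_apply]
  ring

theorem Lap_indicator_sub (hlam : 0 < lam) (hv : Measurable v) {g : ℝ → ℝ}
    (hf : Measurable f) (hf1 : ∫⁻ y in Ioi (0 : ℝ), ‖f y‖ₑ ≠ ⊤)
    (hg : Measurable g) (hg1 : ∫⁻ y in Ioi (0 : ℝ), ‖g y‖ₑ ≠ ⊤)
    {V : ℝ≥0∞} (hVtop : V ≠ ⊤) {k : ℤ}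
    (hV : ∀ᵐ y ∂volume.restrict (dyadic k), ‖v y‖ₑ ≤ V) {x : ℝ} (hx : 0 ≤ x) :
    Lap lam v ((dyadic k).indicator (f - g)) x
      = Lap lam v ((dyadic k).indicator f) x - Lap lam v ((dyadic k).indicator g) x := by
  simp only [Lap_indicator (measurableSet_dyadic k) (dyadic_subset_Ioi k)]
  rw [lapKernel_sub]
  exact integral_sub (integrableOn_lapKernel_dyadic hlam hv hf hf1 hVtop hV hx)
    (integrableOn_lapKernel_dyadic hlam hv hg hg1 hVtop hV hx)

theorem abs_exp_neg_sub_exp_neg_le {a b : ℝ} (ha : 0 ≤ a) (hb : 0 ≤ b) :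
    |Real.exp (-a) - Real.exp (-b)| ≤ |a - b| := by
  wlog hab : a ≤ b generalizing a b
  · rw [abs_sub_comm, abs_sub_comm a]
    exact this hb ha (le_of_not_ge hab)
  have h1 : Real.exp (-b) = Real.exp (-a) * Real.exp (-(b - a)) := by
    rw [← Real.exp_add]; congr 1; ring
  have h2 := Real.one_sub_le_exp_neg (b - a)
  have h3 : Real.exp (-a) ≤ 1 := Real.exp_le_one_iff.2 (by linarith)
  have h4 := Real.exp_pos (-a)
  rw [abs_of_nonneg (sub_nonneg.2 (Real.exp_le_exp.2 (by linarith))), abs_sub_comm,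
    abs_of_nonneg (by linarith), h1]
  nlinarith

/-- The dyadic pieces of `𝓛f` are Lipschitz, uniformly for `f` in the unit ball of `L¹`. -/
theorem abs_Lap_indicator_sub_le (hlam : 0 < lam) (hv : Measurable v)
    (hf : Measurable f) (hf1 : ∫⁻ y in Ioi (0 : ℝ), ‖f y‖ₑ ≤ 1)
    {V : ℝ≥0∞} (hVtop : V ≠ ⊤) {k : ℤ}
    (hV : ∀ᵐ y ∂volume.restrict (dyadic k), ‖v y‖ₑ ≤ V) {x x' : ℝ} (hx : 0 ≤ x) (hx' : 0 ≤ x') :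
    |Lap lam v ((dyadic k).indicator f) x - Lap lam v ((dyadic k).indicator f) x'|
      ≤ ((2 : ℝ) ^ (k + 1)) ^ lam * V.toReal * |x - x'| := by
  have hf1' := ne_top_of_le_ne_top ENNReal.one_ne_top hf1
  simp only [Lap_indicator (measurableSet_dyadic k) (dyadic_subset_Ioi k)]
  rw [← integral_sub (integrableOn_lapKernel_dyadic hlam hv hf hf1' hVtop hV hx)
    (integrableOn_lapKernel_dyadic hlam hv hf hf1' hVtop hV hx')]
  set c : ℝ := ((2 : ℝ) ^ (k + 1)) ^ lam with hc
  have hc0 : 0 ≤ c := by positivity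
  have hE : ‖∫ y in dyadic k, (lapKernel lam v f x y - lapKernel lam v f x' y)‖ₑ
      ≤ ENNReal.ofReal (c * V.toReal * |x - x'|) := by
    calc _ ≤ ∫⁻ y in dyadic k, ‖lapKernel lam v f x y - lapKernel lam v f x' y‖ₑ :=
          enorm_integral_le_lintegral_enorm _
      _ ≤ ∫⁻ y in dyadic k, ENNReal.ofReal (c * V.toReal * |x - x'|) * ‖f y‖ₑ := by
          refine lintegral_mono_ae ?_
          filter_upwards [hV, ae_restrict_mem (measurableSet_dyadic k)] with y hy hyk
          have hy0 : 0 < y := dyadic_subset_Ioi k hyk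
          have hyl : 0 ≤ y ^ lam := by positivity
          have hyc : y ^ lam ≤ c := Real.rpow_le_rpow hy0.le hyk.2.le hlam.le
          have hvy : |v y| ≤ V.toReal := by
            have := ENNReal.toReal_mono hVtop hy
            simpa using this
          rw [Real.enorm_eq_ofReal_abs, Real.enorm_eq_ofReal_abs,
            ← ENNReal.ofReal_mul (by positivity)]
          refine ENNReal.ofReal_le_ofReal ?_
          have hexp := abs_exp_neg_sub_exp_neg_le (mul_nonneg hx hyl) (mul_nonneg hx' hyl)
          rw [← sub_mul, abs_mul, abs_of_nonneg hyl] at hexp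
          have heq : lapKernel lam v f x y - lapKernel lam v f x' y
              = (Real.exp (-(x * y ^ lam)) - Real.exp (-(x' * y ^ lam))) * v y * f y := by
            simp only [lapKernel]; ring
          rw [heq, abs_mul, abs_mul]
          refine mul_le_mul_of_nonneg_right ?_ (abs_nonneg _)
          calc _ ≤ (|x - x'| * y ^ lam) * V.toReal := by gcongr
            _ ≤ (|x - x'| * c) * V.toReal := by gcongr
            _ = _ := by ring
      _ = ENNReal.ofReal (c * V.toReal * |x - x'|) * ∫⁻ y in dyadic k, ‖f y‖ₑ :=
          lintegral_const_mul _ (by fun_prop)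
      _ ≤ ENNReal.ofReal (c * V.toReal * |x - x'|) * 1 := by
          gcongr
          exact (lintegral_mono_set (dyadic_subset_Ioi k)).trans hf1
      _ = _ := mul_one _
  rw [Real.enorm_eq_ofReal_abs] at hE
  exact (ENNReal.ofReal_le_ofReal_iff (by positivity)).1 hE

/-- A subsequence along which every dyadic piece of `𝓛fₙ` converges pointwise. -/
theorem exists_subseq_cauchySeq_Lap_indicator (hlam : 0 < lam) (hv : Measurable v)
    {f : ℕ → ℝ → ℝ} (hf : ∀ n, Measurable (f n))
    (hf1 : ∀ n, ∫⁻ y in Ioi (0 : ℝ), ‖f n y‖ₑ ≤ 1)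
    {V : ℤ → ℝ≥0∞} (hVtop : ∀ k, V k ≠ ⊤)
    (hV : ∀ k, ∀ᵐ y ∂volume.restrict (dyadic k), ‖v y‖ₑ ≤ V k) :
    ∃ φ : ℕ → ℕ, StrictMono φ ∧ ∀ k, ∀ x : ℝ, 0 ≤ x →
      CauchySeq fun n => Lap lam v ((dyadic k).indicator (f (φ n))) x := by
  let z : ℕ → ℤ × ℚ≥0 → ℝ := fun n i => Lap lam v ((dyadic i.1).indicator (f n)) (i.2 : ℝ)
  have hcomp : IsCompact (Set.pi univ fun i : ℤ × ℚ≥0 =>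
      Metric.closedBall (0 : ℝ) (V i.1).toReal) :=
    isCompact_univ_pi fun i => isCompact_closedBall _ _
  have hz : ∀ n, z n ∈ Set.pi univ fun i : ℤ × ℚ≥0 =>
      Metric.closedBall (0 : ℝ) (V i.1).toReal := by
    rintro n ⟨k, r⟩ -
    rw [mem_closedBall_zero_iff]
    have hr : (0 : ℝ) ≤ (r : ℝ) := by positivity
    have h1 := enorm_Lap_indicator_le (measurableSet_dyadic k) (by positivity)
      (dyadic_subset_Ici k) hlam (hf n) (hV k) hr
    have h2 : ‖z n (k, r)‖ₑ ≤ V k := by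
      refine h1.trans ?_
      calc _ ≤ (1 : ℝ≥0∞) * (V k * 1) := by
            gcongr
            · exact ENNReal.ofReal_le_one.2
                (Real.exp_le_one_iff.2 (neg_nonpos.2 (by positivity)))
            · exact (lintegral_mono_set (dyadic_subset_Ioi k)).trans (hf1 n)
        _ = V k := by simp
    simpa using ENNReal.toReal_mono (hVtop k) h2
  obtain ⟨w, -, φ, hφ, hlim⟩ := hcomp.tendsto_subseq hz
  refine ⟨φ, hφ, fun k x hx => Metric.cauchySeq_iff.2 fun ε hε => ?_⟩
  set C : ℝ := ((2 : ℝ) ^ (k + 1)) ^ lam * (V k).toReal with hC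
  have hC0 : 0 ≤ C := by positivity
  obtain ⟨r, hr1, hr2⟩ := exists_rat_btwn (show x < x + ε / (4 * (C + 1)) by
    have : 0 < ε / (4 * (C + 1)) := by positivity
    linarith)
  have hr0 : (0 : ℚ) ≤ r := by exact_mod_cast hx.trans hr1.le
  lift r to ℚ≥0 using hr0
  have hr0 : (0 : ℝ) ≤ (r : ℝ) := by positivity
  have hxr : C * |x - r| ≤ ε / 4 := by
    have h1 : |x - r| ≤ ε / (4 * (C + 1)) := by
      rw [abs_le]
      push_cast at hr1 hr2
      constructor <;> linarith
    have h2 : C * |x - r| ≤ (C + 1) * (ε / (4 * (C + 1))) := by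
      gcongr
      linarith
    have h3 : (C + 1) * (ε / (4 * (C + 1))) = ε / 4 := by field_simp
    linarith
  have hcau := ((tendsto_pi_nhds.1 hlim) (k, r)).cauchySeq
  obtain ⟨N, hN⟩ := Metric.cauchySeq_iff.1 hcau (ε / 3) (by positivity)
  refine ⟨N, fun m hm n hn => ?_⟩
  have h0 := hN m hm n hn
  have hm1 := abs_Lap_indicator_sub_le hlam hv (hf (φ m)) (hf1 _) (hVtop k) (hV k) hx hr0
  have hn1 := abs_Lap_indicator_sub_le hlam hv (hf (φ n)) (hf1 _) (hVtop k) (hV k) hx hr0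
  rw [← hC] at hm1 hn1
  simp only [Function.comp_apply, z, Real.dist_eq] at h0 ⊢
  rw [abs_le] at hm1 hn1
  rw [abs_lt] at h0 ⊢
  constructor <;> linarith

theorem tendsto_dM_Lap_indicator_sub (hlam : 0 < lam) (hq0 : 0 < q) (hv : Measurable v)
    {f : ℕ → ℝ → ℝ} (hf : ∀ n, Measurable (f n))
    (hf1 : ∀ n, ∫⁻ y in Ioi (0 : ℝ), ‖f n y‖ₑ ≤ 1)
    {V : ℝ≥0∞} (hVtop : V ≠ ⊤) {k : ℤ}
    (hV : ∀ᵐ y ∂volume.restrict (dyadic k), ‖v y‖ₑ ≤ V)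
    (hcau : ∀ x : ℝ, 0 ≤ x → CauchySeq fun n => Lap lam v ((dyadic k).indicator (f n)) x) :
    Tendsto (fun i : ℕ × ℕ => dM q (Lap lam v ((dyadic k).indicator (f i.1 - f i.2))))
      atTop (𝓝 0) := by
  simp only [dM_eq]
  have hzero : (0 : ℝ≥0∞) = ∫⁻ x in Ioi (0 : ℝ), 0 := by simp
  rw [hzero]
  refine tendsto_lintegral_filter_of_dominated_convergence
    (fun x => (ENNReal.ofReal (Real.exp (-(x * ((2 : ℝ) ^ k) ^ lam))) * (V * 2)) ^ q) ?_ ?_ ?_ ?_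
  · refine Eventually.of_forall fun i => ?_
    exact (measurable_Lap hv
      (((hf _).sub (hf _)).indicator (measurableSet_dyadic k))).enorm.pow_const q
  · refine Eventually.of_forall fun i => ?_
    filter_upwards [ae_restrict_mem measurableSet_Ioi] with x hx
    gcongr
    refine (enorm_Lap_indicator_le (measurableSet_dyadic k) (by positivity)
      (dyadic_subset_Ici k) hlam ((hf _).sub (hf _)) hV (le_of_lt hx)).trans ?_
    gcongr
    refine (lintegral_mono_set (dyadic_subset_Ioi k)).trans ?_
    exact lintegral_enorm_sub_le_two (hf _) (hf1 _) (hf1 _)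
  · rw [lintegral_exp_mul_rpow (by positivity) hq0]
    exact ENNReal.mul_ne_top ENNReal.ofReal_ne_top
      (ENNReal.rpow_ne_top_of_nonneg hq0.le (ENNReal.mul_ne_top hVtop (by simp)))
  · filter_upwards [ae_restrict_mem measurableSet_Ioi] with x hx
    have hx0 : 0 ≤ x := le_of_lt hx
    have h1 : Tendsto (fun i : ℕ × ℕ => edist (Lap lam v ((dyadic k).indicator (f i.1)) x)
        (Lap lam v ((dyadic k).indicator (f i.2)) x)) atTop (𝓝 0) := by
      simp only [edist_dist]
      rw [← ENNReal.ofReal_zero]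
      exact ENNReal.tendsto_ofReal (cauchySeq_iff_tendsto_dist_atTop_0.1 (hcau x hx0))
    have h2 := ((ENNReal.continuous_rpow_const (y := q)).tendsto 0).comp h1
    rw [ENNReal.zero_rpow_of_pos hq0] at h2
    refine h2.congr fun i => ?_
    have hne := fun n => ne_top_of_le_ne_top ENNReal.one_ne_top (hf1 n)
    rw [Function.comp_apply, edist_eq_enorm_sub,
      Lap_indicator_sub hlam hv (hf _) (hne _) (hf _) (hne _) hVtop hV hx0]

theorem Lap_sub_eq {g : ℝ → ℝ} {x : ℝ} (hf : IntegrableOn (lapKernel lam v f x) (Ioi 0))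
    (hg : IntegrableOn (lapKernel lam v g x) (Ioi 0)) :
    Lap lam v (f - g) x = Lap lam v f x - Lap lam v g x := by
  change ∫ y in Ioi 0, lapKernel lam v (f - g) x y = _
  rw [lapKernel_sub]
  exact integral_sub hf hg

theorem LapCompactM_of_dyadicConst (hlam : 0 < lam) (hq0 : 0 < q) (hq1 : q < 1)
    (hv : Measurable v) {V : ℤ → ℝ≥0∞} (hVtop : ∀ k, V k ≠ ⊤)
    (hV : ∀ k, ∀ᵐ y ∂volume.restrict (dyadic k), ‖v y‖ₑ ≤ V k)
    (hC : ∑' k, dyadicConst lam q V k ^ (1 / (1 - q)) ≠ ⊤) : LapCompactM lam 1 q v := by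
  intro f hf hfN
  have hf1 : ∀ n, ∫⁻ y in Ioi (0 : ℝ), ‖f n y‖ₑ ≤ 1 := fun n => by
    simpa [eN, Real.enorm_eq_ofReal_abs] using hfN n
  have hne := fun n => ne_top_of_le_ne_top ENNReal.one_ne_top (hf1 n)
  obtain ⟨φ, hφ, hcau⟩ := exists_subseq_cauchySeq_Lap_indicator hlam hv hf hf1 hVtop hV
  refine ⟨φ, hφ, fun ε hε => ?_⟩
  set D : ℤ → ℕ × ℕ → ℝ≥0∞ := fun k i =>
    dM q (Lap lam v ((dyadic k).indicator (f (φ i.1) - f (φ i.2)))) with hD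
  have hDlim : ∀ k, Tendsto (D k) atTop (𝓝 0) := fun k =>
    tendsto_dM_Lap_indicator_sub hlam hq0 hv (fun n => hf (φ n)) (fun n => hf1 (φ n))
      (hVtop k) (hV k) (hcau k)
  have hsum : ∀ m n, dM q (fun x => Lap lam v (f (φ m)) x - Lap lam v (f (φ n)) x)
      ≤ ∑' k, D k (m, n) := by
    intro m n
    simp only [hD, dM_eq]
    rw [← lintegral_tsum fun k => ((measurable_Lap hv (((hf _).sub (hf _)).indicator
      (measurableSet_dyadic k))).enorm.pow_const q).aemeasurable]
    refine lintegral_mono_ae ?_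
    filter_upwards [ae_integrableOn_lapKernel hlam hq0 hq1 hv (hf (φ m)) (hne _) hV hC,
      ae_integrableOn_lapKernel hlam hq0 hq1 hv (hf (φ n)) (hne _) hV hC] with x hxm hxn
    rw [← Lap_sub_eq hxm hxn]
    have hint : IntegrableOn (lapKernel lam v (f (φ m) - f (φ n)) x) (Ioi 0) := by
      rw [lapKernel_sub]
      exact hxm.sub hxn
    exact (ENNReal.rpow_le_rpow (enorm_Lap_le_tsum hint) hq0.le).trans
      (ENNReal.rpow_tsum_le_tsum_rpow _ hq0 hq1.le)
  have htail : ∀ (T : Finset ℤ) (i : ℕ × ℕ), ∑' k : {k // k ∉ T}, D k i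
      ≤ (∑' k : {k // k ∉ T}, dyadicConst lam q V k ^ (1 / (1 - q))) ^ (1 - q) * 2 ^ q := by
    intro T i
    calc _ ≤ ∑' k : {k // k ∉ T}, dyadicConst lam q V k
            * (∫⁻ y in dyadic k, ‖(f (φ i.1) - f (φ i.2)) y‖ₑ) ^ q :=
          ENNReal.tsum_le_tsum fun k => dM_Lap_indicator_le (measurableSet_dyadic k)
            (by positivity) (dyadic_subset_Ici k) hlam hq0 ((hf _).sub (hf _)) (hV k)
      _ ≤ _ := ENNReal.tsum_mul_rpow_le _ _ hq0 hq1
      _ ≤ _ := by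
          gcongr
          refine (ENNReal.tsum_comp_le_tsum_of_injective Subtype.val_injective
            fun k => ∫⁻ y in dyadic k, ‖(f (φ i.1) - f (φ i.2)) y‖ₑ).trans ?_
          rw [← lintegral_Ioi_eq_tsum_dyadic]
          exact lintegral_enorm_sub_le_two (hf _) (hf1 _) (hf1 _)
  have htail0 : Tendsto (fun T : Finset ℤ =>
      (∑' k : {k // k ∉ T}, dyadicConst lam q V k ^ (1 / (1 - q))) ^ (1 - q) * (2 : ℝ≥0∞) ^ q)
      atTop (𝓝 0) := by
    have h1 := ((ENNReal.continuous_rpow_const (y := 1 - q)).tendsto 0).comp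
      (ENNReal.tendsto_tsum_compl_atTop_zero hC)
    rw [ENNReal.zero_rpow_of_pos (by linarith)] at h1
    simpa using ENNReal.Tendsto.mul_const (b := (2 : ℝ≥0∞) ^ q) h1
      (Or.inr (ENNReal.rpow_ne_top_of_nonneg hq0.le (by simp)))
  have hε2 : 0 < ENNReal.ofReal (ε / 2) := ENNReal.ofReal_pos.2 (by positivity)
  obtain ⟨T, hT⟩ := (htail0.eventually (gt_mem_nhds hε2)).exists
  have hfinsum : Tendsto (fun i => ∑ k ∈ T, D k i) atTop (𝓝 0) := by
    simpa using tendsto_finsetSum T fun k _ => hDlim k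
  obtain ⟨⟨N₁, N₂⟩, hN⟩ := eventually_atTop.1 (hfinsum.eventually (gt_mem_nhds hε2))
  refine ⟨max N₁ N₂, fun m hm n hn => ?_⟩
  calc _ ≤ ∑' k, D k (m, n) := hsum m n
    _ = ∑ k ∈ T, D k (m, n) + ∑' k : {k // k ∉ T}, D k (m, n) :=
        (ENNReal.sum_add_tsum_compl T _).symm
    _ < ENNReal.ofReal (ε / 2) + ENNReal.ofReal (ε / 2) :=
        ENNReal.add_lt_add (hN (m, n) ⟨(le_max_left _ _).trans hm, (le_max_right _ _).trans hn⟩)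
          ((htail T _).trans_lt hT)
    _ = ENNReal.ofReal ε := by
        rw [← ENNReal.ofReal_add (by positivity) (by positivity), add_halves]

theorem dyadicConst_rpow_le (hlam : 0 < lam) (hq0 : 0 < q) (hq1 : q < 1) {W : ℝ → ℝ≥0∞}
    (hW : Monotone W) (k : ℤ) :
    dyadicConst lam q (fun k => W (2 ^ (k + 1))) k ^ (1 / (1 - q))
      ≤ ENNReal.ofReal ((1 / q) ^ (1 / (1 - q)) * 4 ^ (lam / (1 - q) + 1) / 2)
        * ∫⁻ t in dyadic (k + 1), ENNReal.ofReal t ^ (-(lam / (1 - q)) - 1)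
          * W t ^ (q / (1 - q)) := by
  have hq' : 0 < 1 - q := by linarith
  set s : ℝ := lam / (1 - q) with hs
  have hs0 : 0 < s := by positivity
  set u : ℝ := (2 : ℝ) ^ k with hu
  have hu0 : 0 < u := by positivity
  have hu1 : (2 : ℝ) ^ (k + 1) = 2 * u := by rw [zpow_add_one₀ two_ne_zero, mul_comm]
  have hu2 : (2 : ℝ) ^ (k + 1 + 1) = 4 * u := by rw [zpow_add_one₀ two_ne_zero, hu1]; ring
  have hlow : ENNReal.ofReal (4 * u) ^ (-s - 1) * W (2 * u) ^ (q / (1 - q))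
      * ENNReal.ofReal (2 * u)
      ≤ ∫⁻ t in dyadic (k + 1), ENNReal.ofReal t ^ (-s - 1) * W t ^ (q / (1 - q)) := by
    have hvol : volume (dyadic (k + 1)) = ENNReal.ofReal (2 * u) := by
      rw [dyadic, Real.volume_Ico, hu1, hu2]; congr 1; ring
    rw [← hvol, ← setLIntegral_const]
    refine setLIntegral_mono' (measurableSet_dyadic _) fun t ht => ?_
    have ht1 : 2 * u ≤ t := hu1 ▸ ht.1
    have ht2 : t ≤ 4 * u := hu2 ▸ ht.2.le
    refine mul_le_mul' ?_ (ENNReal.rpow_le_rpow (hW ht1) (by positivity))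
    rw [show -s - 1 = -(s + 1) by ring, ENNReal.rpow_neg, ENNReal.rpow_neg, ENNReal.inv_le_inv]
    gcongr
  refine le_trans (le_of_eq ?_) (mul_le_mul_right hlow _)
  rw [dyadicConst, ENNReal.mul_rpow_of_nonneg _ _ (by positivity), ← ENNReal.rpow_mul, hu1,
    ENNReal.ofReal_rpow_of_pos (by positivity), ENNReal.ofReal_rpow_of_pos (by positivity),
    mul_one_div, mul_right_comm (ENNReal.ofReal _) (W _ ^ _), ← mul_assoc,
    ← ENNReal.ofReal_mul (by positivity), ← ENNReal.ofReal_mul (by positivity)]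
  congr 2
  rw [Real.mul_rpow (by norm_num) hu0.le, ← hu, Real.div_rpow zero_le_one (by positivity),
    Real.div_rpow zero_le_one hq0.le, Real.one_rpow, Real.mul_rpow (by positivity) hq0.le,
    ← Real.rpow_mul hu0.le, mul_one_div, ← hs,
    show -s - 1 = -(s + 1) by ring, Real.rpow_neg (by norm_num), Real.rpow_neg hu0.le,
    Real.rpow_add_one hu0.ne']
  field_simp

theorem LapCompactM_of_lintegral_ne_top (hlam : 0 < lam) (hq0 : 0 < q) (hq1 : q < 1)
    (hv : Measurable v) (hvpos : ∀ y, 0 ≤ v y)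
    (hI : ∫⁻ t in Ioi (0 : ℝ), (ENNReal.ofReal t) ^ (-(lam / (1 - q)) - 1) *
      (essSup (fun x => ENNReal.ofReal (v x)) (volume.restrict (Ioo (0 : ℝ) t)))
        ^ (q / (1 - q)) ≠ ⊤) : LapCompactM lam 1 q v := by
  have hq' : 0 < 1 - q := by linarith
  set W : ℝ → ℝ≥0∞ := fun t =>
    essSup (fun x => ENNReal.ofReal (v x)) (volume.restrict (Ioo (0 : ℝ) t)) with hWdef
  have hW : Monotone W := fun s t hst => essSup_mono_measure'
    (Measure.restrict_mono (Ioo_subset_Ioo_right hst) le_rfl)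
  have hC : ∑' k, dyadicConst lam q (fun k => W (2 ^ (k + 1))) k ^ (1 / (1 - q)) ≠ ⊤ := by
    refine ne_top_of_le_ne_top ?_
      (ENNReal.tsum_le_tsum fun k => dyadicConst_rpow_le hlam hq0 hq1 hW k)
    have hshift := (Equiv.addRight (1 : ℤ)).tsum_eq fun k =>
      ∫⁻ t in dyadic k, ENNReal.ofReal t ^ (-(lam / (1 - q)) - 1) * W t ^ (q / (1 - q))
    simp only [Equiv.coe_addRight] at hshift
    rw [ENNReal.tsum_mul_left, hshift, ← lintegral_Ioi_eq_tsum_dyadic]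
    exact ENNReal.mul_ne_top ENNReal.ofReal_ne_top hI
  refine LapCompactM_of_dyadicConst hlam hq0 hq1 hv (V := fun k => W (2 ^ (k + 1))) ?_ ?_ hC
  · intro k htop
    refine ENNReal.ne_top_of_tsum_ne_top hC k ?_
    have h0 : (0 : ℝ) < 1 / ((2 ^ k) ^ lam * q) := by positivity
    simp only [dyadicConst, htop, ENNReal.top_rpow_of_pos hq0]
    rw [ENNReal.mul_top (ENNReal.ofReal_pos.2 h0).ne', ENNReal.top_rpow_of_pos (by positivity)]
  · intro k
    have hsub : dyadic k ⊆ Ioo (0 : ℝ) (2 ^ (k + 1)) :=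
      fun y hy => ⟨dyadic_subset_Ioi k hy, hy.2⟩
    filter_upwards [ae_restrict_of_ae_restrict_of_subset hsub
      (ENNReal.ae_le_essSup fun x => ENNReal.ofReal (v x))] with y hy
    rwa [Real.enorm_eq_ofReal (hvpos y)]

/-- If `t^{-λ/q} v(t)` is essentially unbounded, then on some dyadic interval there is a set of
positive measure where `v` is bounded and exceeds `n t^{λ/q}`. -/
theorem exists_dyadic_subset_of_essSup_eq_top (hv : Measurable v)
    (hsup : essSup (fun t => (ENNReal.ofReal t) ^ (-(lam / q)) * ENNReal.ofReal (v t))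
      (volume.restrict (Ioi (0 : ℝ))) = ⊤) (n : ℕ) :
    ∃ (k : ℤ) (j : ℕ) (E : Set ℝ), MeasurableSet E ∧ E ⊆ dyadic k ∧ volume E ≠ 0 ∧
      ∀ y ∈ E, n * y ^ (lam / q) ≤ v y ∧ v y ≤ j := by
  set g : ℝ → ℝ≥0∞ := fun t => (ENNReal.ofReal t) ^ (-(lam / q)) * ENNReal.ofReal (v t) with hg
  have hgm : Measurable g := by fun_prop
  let E : ℤ × ℕ → Set ℝ := fun i => dyadic i.1 ∩ ({t | (n : ℝ≥0∞) < g t} ∩ {t | v t ≤ i.2})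
  have hE : ∃ i, volume (E i) ≠ 0 := by
    by_contra! hnull
    have hU : volume (⋃ i, E i) = 0 := measure_iUnion_null hnull
    have hle : essSup g (volume.restrict (Ioi (0 : ℝ))) ≤ n := by
      refine essSup_le_of_ae_le _ ?_
      rw [EventuallyLE, ae_restrict_iff' measurableSet_Ioi]
      filter_upwards [measure_eq_zero_iff_ae_notMem.1 hU] with t ht ht0
      by_contra! hlt
      obtain ⟨k, hk⟩ := exists_mem_Ico_zpow (y := (2 : ℝ)) ht0 one_lt_two
      obtain ⟨j, hj⟩ := exists_nat_ge (v t)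
      exact ht (mem_iUnion.2 ⟨(k, j), hk, hlt, hj⟩)
    rw [hsup] at hle
    exact ENNReal.natCast_ne_top n (top_le_iff.1 hle)
  obtain ⟨⟨k, j⟩, hkj⟩ := hE
  refine ⟨k, j, E (k, j), (measurableSet_dyadic k).inter
    ((measurableSet_lt measurable_const hgm).inter (measurableSet_le hv measurable_const)),
    inter_subset_left, hkj, fun y hy => ⟨?_, hy.2.2⟩⟩
  have hy0 : 0 < y := dyadic_subset_Ioi k hy.1
  have hlt : (n : ℝ≥0∞) < g y := hy.2.1
  rw [hg, ← ENNReal.ofReal_natCast] at hlt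
  simp only [ENNReal.ofReal_rpow_of_pos hy0] at hlt
  rw [← ENNReal.ofReal_mul (by positivity)] at hlt
  have h1 := (ENNReal.ofReal_lt_ofReal_iff'.1 hlt).1
  rw [Real.rpow_neg hy0.le, inv_mul_eq_div, lt_div_iff₀ (by positivity)] at h1
  exact h1.le

theorem exists_unit_dM_Lap_ge (hlam : 0 < lam) (hq0 : 0 < q) (hv : Measurable v)
    (hvpos : ∀ y, 0 ≤ v y)
    (hsup : essSup (fun t => (ENNReal.ofReal t) ^ (-(lam / q)) * ENNReal.ofReal (v t))
      (volume.restrict (Ioi (0 : ℝ))) = ⊤) (n : ℕ) :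
    ∃ f : ℝ → ℝ, Measurable f ∧ eN 1 f ≤ 1 ∧ dM q (Lap lam v f) ≠ ⊤ ∧
      ENNReal.ofReal (1 / (2 ^ lam * q)) * (n : ℝ≥0∞) ^ q ≤ dM q (Lap lam v f) := by
  obtain ⟨k, j, E, hEm, hEk, hE0, hE⟩ := exists_dyadic_subset_of_essSup_eq_top hv hsup n
  have hEpos : E ⊆ Ioi 0 := hEk.trans (dyadic_subset_Ioi k)
  have hEtop : volume E ≠ ⊤ :=
    ne_top_of_le_ne_top (by simp [dyadic]) (measure_mono hEk)
  set M : ℝ := (volume E).toReal with hM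
  have hM0 : 0 < M := ENNReal.toReal_pos hE0 hEtop
  have hnorm : ∫⁻ y in E, ‖M⁻¹‖ₑ = 1 := by
    rw [setLIntegral_const, Real.enorm_eq_ofReal (by positivity), ← ENNReal.ofReal_toReal hEtop,
      ← hM, ← ENNReal.ofReal_mul (by positivity), inv_mul_cancel₀ hM0.ne', ENNReal.ofReal_one]
  have hvE : ∀ᵐ y ∂volume.restrict E, ‖v y‖ₑ ≤ (j : ℝ≥0∞) := by
    filter_upwards [ae_restrict_mem hEm] with y hy
    rw [Real.enorm_eq_ofReal (hvpos y), ← ENNReal.ofReal_natCast]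
    exact ENNReal.ofReal_le_ofReal (hE y hy).2
  have hEb : E ⊆ Ici ((2 : ℝ) ^ k) := hEk.trans (dyadic_subset_Ici k)
  have hb : (0 : ℝ) < 2 ^ k := by positivity
  refine ⟨E.indicator fun _ => M⁻¹, measurable_const.indicator hEm, ?_, ?_, ?_⟩
  · have : ∫⁻ y in Ioi (0 : ℝ), ‖E.indicator (fun _ => M⁻¹) y‖ₑ = 1 := by
      simp only [enorm_indicator_eq_indicator_enorm]
      rw [setLIntegral_indicator hEm, inter_eq_self_of_subset_left hEpos, hnorm]
    simp only [eN, ← Real.enorm_eq_ofReal_abs, ENNReal.rpow_one, this]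
    simp
  · refine ne_top_of_le_ne_top ?_
      (dM_Lap_indicator_le hEm hb hEb hlam hq0 measurable_const hvE)
    rw [hnorm]
    exact ENNReal.mul_ne_top (ENNReal.mul_ne_top ENNReal.ofReal_ne_top
      (ENNReal.rpow_ne_top_of_nonneg hq0.le (by simp))) (by simp)
  · set u : ℝ := (2 : ℝ) ^ k with hu
    have hu1 : (2 : ℝ) ^ (k + 1) = 2 * u := by rw [zpow_add_one₀ two_ne_zero, mul_comm]
    have hconst : ENNReal.ofReal (1 / (2 ^ lam * q)) * (n : ℝ≥0∞) ^ q
        = ENNReal.ofReal (1 / ((2 * u) ^ lam * q))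
          * ENNReal.ofReal (n * u ^ (lam / q)) ^ q := by
      rw [ENNReal.ofReal_rpow_of_nonneg (by positivity) hq0.le, ← ENNReal.ofReal_natCast,
        ENNReal.ofReal_rpow_of_nonneg (by positivity) hq0.le, ← ENNReal.ofReal_mul (by positivity),
        ← ENNReal.ofReal_mul (by positivity), Real.mul_rpow (by positivity) (by positivity),
        Real.mul_rpow (by positivity) (by positivity), ← Real.rpow_mul hb.le,
        div_mul_cancel₀ _ hq0.ne']
      congr 1
      field_simp
    rw [hconst, ← lintegral_exp_mul_rpow (by positivity) hq0, dM_eq]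
    refine setLIntegral_mono' measurableSet_Ioi fun x hx => ?_
    have hx0 : 0 < x := hx
    gcongr
    rw [Lap_indicator hEm hEpos, ← ENNReal.ofReal_mul (by positivity)]
    refine le_trans (ENNReal.ofReal_le_ofReal ?_) (Real.ofReal_le_enorm _)
    have hint : IntegrableOn (lapKernel lam v (fun _ => M⁻¹) x) E := by
      refine ⟨(measurable_lapKernel hv measurable_const x).aestronglyMeasurable, ?_⟩
      refine (lintegral_lapKernel_le hEm hb hEb hlam measurable_const hvE hx0.le).trans_lt ?_
      rw [hnorm]
      exact ENNReal.mul_lt_top ENNReal.ofReal_lt_top (by simp)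
    calc _ = ∫ y in E, Real.exp (-(x * (2 * u) ^ lam)) * M⁻¹ * (n * u ^ (lam / q)) := by
          rw [setIntegral_const, smul_eq_mul, Measure.real, ← hM]
          field_simp
      _ ≤ _ := by
          refine setIntegral_mono_on (integrableOn_const hEtop) hint hEm fun y hy => ?_
          have hy0 : 0 < y := hEpos hy
          have hyu : u ≤ y := hEb hy
          have hy2 : y ≤ 2 * u := hu1 ▸ (hEk hy).2.le
          have hvy : n * u ^ (lam / q) ≤ v y := le_trans (by gcongr) (hE y hy).1
          unfold lapKernel
          gcongr

theorem essSup_lt_top_of_LapCompactM (hlam : 0 < lam) (hq0 : 0 < q) (hq1 : q < 1)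
    (hv : Measurable v) (hvpos : ∀ y, 0 ≤ v y) (hcomp : LapCompactM lam 1 q v) :
    essSup (fun t => (ENNReal.ofReal t) ^ (-(lam / q)) * ENNReal.ofReal (v t))
      (volume.restrict (Ioi (0 : ℝ))) < ⊤ := by
  by_contra hsup
  rw [not_lt_top_iff] at hsup
  choose f hf hf1 hfin hlow using exists_unit_dM_Lap_ge hlam hq0 hv hvpos hsup
  obtain ⟨φ, hφ, hcau⟩ := hcomp f hf hf1
  obtain ⟨N, hN⟩ := hcau 1 one_pos
  have hbound : ∀ m, N ≤ m → ENNReal.ofReal (1 / (2 ^ lam * q)) * (m : ℝ≥0∞) ^ q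
      ≤ 1 + dM q (Lap lam v (f (φ N))) := by
    intro m hm
    calc _ ≤ ENNReal.ofReal (1 / (2 ^ lam * q)) * (φ m : ℝ≥0∞) ^ q := by
          gcongr
          exact hφ.le_apply
      _ ≤ dM q (Lap lam v (f (φ m))) := hlow _
      _ ≤ dM q (fun x => Lap lam v (f (φ m)) x - Lap lam v (f (φ N)) x)
          + dM q (Lap lam v (f (φ N))) := by
          simp only [dM_eq]
          rw [← lintegral_add_right _ ((measurable_Lap hv (hf _)).enorm.pow_const q)]
          refine lintegral_mono fun x => ?_
          refine le_trans ?_ (ENNReal.rpow_add_le_add_rpow _ _ hq0.le hq1.le)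
          gcongr
          simpa using enorm_add_le (Lap lam v (f (φ m)) x - Lap lam v (f (φ N)) x)
            (Lap lam v (f (φ N)) x)
      _ ≤ _ := by
          gcongr
          simpa using (hN m hm N le_rfl).le
  have hc : ENNReal.ofReal (1 / (2 ^ lam * q)) ≠ 0 :=
    (ENNReal.ofReal_pos.2 (by positivity)).ne'
  have hlim : Tendsto (fun m : ℕ => ENNReal.ofReal (1 / (2 ^ lam * q)) * (m : ℝ≥0∞) ^ q)
      atTop (𝓝 ⊤) := by
    have h1 := ((ENNReal.continuous_rpow_const (y := q)).tendsto ⊤).comp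
      ENNReal.tendsto_nat_nhds_top
    rw [ENNReal.top_rpow_of_pos hq0] at h1
    have h2 := ENNReal.Tendsto.const_mul (a := ENNReal.ofReal (1 / (2 ^ lam * q))) h1
      (Or.inl ENNReal.top_ne_zero)
    rwa [ENNReal.mul_top hc] at h2
  have htop := le_of_tendsto hlim (eventually_atTop.2 ⟨N, hbound⟩)
  exact ENNReal.add_ne_top.2 ⟨ENNReal.one_ne_top, hfin _⟩ (top_le_iff.1 htop)

end

theorem stmt9 (lam q : ℝ) (hlam : 0 < lam) (hq0 : 0 < q) (hq1 : q < 1)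
    (v : ℝ → ℝ) (hv : Measurable v) (hvpos : ∀ y, 0 ≤ v y)
    (B : ℝ≥0∞)
    -- `B = (∫_0^∞ t^{-λ/(1-q)-1} v̄₀(t)^{q/(1-q)} dt)^{(1-q)/q}`,
    -- where `v̄₀(t) = ess sup_{0<x<t} v(x)`
    (hB : B = (∫⁻ t in Ioi (0:ℝ), (ENNReal.ofReal t) ^ (-(lam/(1 - q)) - 1) *
      (essSup (fun x => ENNReal.ofReal (v x)) (volume.restrict (Ioo (0:ℝ) t)))
        ^ (q/(1 - q))) ^ ((1 - q)/q)) :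
    (B < ⊤ → LapCompactM lam 1 q v)
      ∧ (LapCompactM lam 1 q v →
          essSup (fun t => (ENNReal.ofReal t) ^ (-(lam/q)) * ENNReal.ofReal (v t))
            (volume.restrict (Ioi (0:ℝ))) < ⊤) := by
  have hq' : 0 < (1 - q) / q := div_pos (by linarith) hq0
  refine ⟨fun hBtop => ?_, essSup_lt_top_of_LapCompactM hlam hq0 hq1 hv hvpos⟩
  rw [hB, ENNReal.rpow_lt_top_iff_of_pos hq'] at hBtop
  exact LapCompactM_of_lintegral_ne_top hlam hq0 hq1 hv hvpos hBtop.ne
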